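/- Failure of ω-categoricity for DLO: there exist B-models M and N over the signature of DLO, both with countable domain, whose designated worlds satisfy all axioms of DLO, and sentences A and B such that M,s ⊨ A but N,s ⊭ A, and N,s ⊨ B but M,s ⊭ B. Explicitly one may take A = (∀x(x=x)) → A3 and B = A3 ∧ ¬A3, where A3 is the transitivity axiom ∀x,y,z((x<y ∧ y<z)→x<z). Hence there are countable models of DLO that are not elementarily equivalent. -/

import Mathlib

namespace RM

/-- A first-order signature: function symbols with arities and
relation symbols with arities. -/
structure Signature where
  Func : Type
  farity : Func → ℕ
  Rel : Type
  rarity : Rel → ℕ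

variable {σ : Signature}

/-- Terms over a signature, with variables indexed by `ℕ`. -/
inductive Term (σ : Signature) : Type where
  | var : ℕ → Term σ
  | func : (f : σ.Func) → (Fin (σ.farity f) → Term σ) → Term σ

/-- Formulas of the quantificational relevant language:
`⊥`, `⊤`, (logical) equality, atomic relations, `∧`, `∨`, `¬`, `→`, `∀`, `∃`. -/
inductive Formula (σ : Signature) : Type where
  | falsum : Formula σ
  | verum : Formula σ
  | equal : Term σ → Term σ → Formula σ
  | rel : (r : σ.Rel) → (Fin (σ.rarity r) → Term σ) → Formula σ
  | and : Formula σ → Formula σ → Formula σ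
  | or : Formula σ → Formula σ → Formula σ
  | neg : Formula σ → Formula σ
  | imp : Formula σ → Formula σ → Formula σ
  | all : ℕ → Formula σ → Formula σ
  | ex : ℕ → Formula σ → Formula σ

/-- The relevant biconditional `A ↔ B := (A → B) ∧ (B → A)`. -/
def Formula.iff (A B : Formula σ) : Formula σ := .and (.imp A B) (.imp B A)

/-- Free variables of a term. -/
def Term.fv : Term σ → Set ℕ
  | .var n => {n}
  | .func _ ts => ⋃ i, (ts i).fv

/-- Free variables of a formula. -/
def Formula.fv : Formula σ → Set ℕ
  | .falsum => ∅
  | .verum => ∅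
  | .equal t u => t.fv ∪ u.fv
  | .rel _ ts => ⋃ i, (ts i).fv
  | .and A B => A.fv ∪ B.fv
  | .or A B => A.fv ∪ B.fv
  | .imp A B => A.fv ∪ B.fv
  | .neg A => A.fv
  | .all x A => A.fv \ {x}
  | .ex x A => A.fv \ {x}

/-- Quantifier-free formulas. -/
def Formula.QFree : Formula σ → Prop
  | .falsum => True
  | .verum => True
  | .equal _ _ => True
  | .rel _ _ => True
  | .and A B => A.QFree ∧ B.QFree
  | .or A B => A.QFree ∧ B.QFree
  | .imp A B => A.QFree ∧ B.QFree
  | .neg A => A.QFree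
  | .all _ _ => False
  | .ex _ _ => False

/-- A sentence is a formula with no free variables. -/
def Formula.Sentence (A : Formula σ) : Prop := A.fv = ∅

/-- A `B`-model (Routley–Meyer model for the basic relevant logic **B**):
worlds `W`, ternary relation `R`, domain `D`, Routley star `*`,
designated world `s`, world-independent interpretation of function symbols,
world-relative valuation `V` of relation symbols, subject to the usual
conditions; the logical equality symbol is always interpreted as real identity. -/
structure BModel (σ : Signature) where
  W : Type
  R : W → W → W → Prop
  D : Type
  dne : Nonempty D
  star : W → W
  s : W
  interpFunc : (f : σ.Func) → (Fin (σ.farity f) → D) → D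
  V : W → (r : σ.Rel) → (Fin (σ.rarity r) → D) → Prop
  base : ∀ α, R s α α
  btrans : ∀ α β γ δ, R s α β → R β γ δ → R α γ δ
  star_star : ∀ α, star (star α) = α
  star_anti : ∀ α β, R s α β → R s (star β) (star α)
  hered : ∀ α β, R s α β → ∀ r v, V α r v → V β r v

namespace BModel

variable (M : BModel σ)

/-- Evaluation of a term under an assignment. -/
def evalT (a : ℕ → M.D) : Term σ → M.D
  | .var n => a n
  | .func f ts => M.interpFunc f fun i => evalT a (ts i)

/-- Truth of a formula at a world, under an assignment of domain
elements to variables (Routley–Meyer truth conditions). -/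
def Truth : M.W → (ℕ → M.D) → Formula σ → Prop
  | _, _, .falsum => False
  | _, _, .verum => True
  | _, a, .equal t u => M.evalT a t = M.evalT a u
  | w, a, .rel r ts => M.V w r fun i => M.evalT a (ts i)
  | w, a, .and A B => Truth w a A ∧ Truth w a B
  | w, a, .or A B => Truth w a A ∨ Truth w a B
  | w, a, .neg A => ¬ Truth (M.star w) a A
  | w, a, .imp A B => ∀ w₁ w₂, M.R w w₁ w₂ → Truth w₁ a A → Truth w₂ a B
  | w, a, .all x A => ∀ d : M.D, Truth w (Function.update a x d) A
  | w, a, .ex x A => ∃ d : M.D, Truth w (Function.update a x d) A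

/-- `M` satisfies `A` (at the designated world, under every assignment). -/
def SatAx (A : Formula σ) : Prop := ∀ a : ℕ → M.D, M.Truth M.s a A

/-- `M` satisfies the theory `T` at its designated world. -/
def SatTheory (T : Set (Formula σ)) : Prop := ∀ A ∈ T, M.SatAx A

/-- Seriality: every world sees some pair via `R`. -/
def Serial : Prop := ∀ x : M.W, ∃ y z, M.R x y z

/-- The frame condition corresponding to the axiom `K`: `Rαβγ → Rsαγ`. -/
def Kcond : Prop := ∀ α β γ, M.R α β γ → M.R M.s α γ

/-- The additional frame conditions making a `B`-model an `RM`-model. -/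
def IsRM : Prop :=
  (∀ α β γ, M.R α β γ → M.R α (M.star γ) (M.star β)) ∧
  (∀ α β γ, M.R α β γ → M.R α γ β) ∧
  (∀ α, M.R α α α) ∧
  (∀ α β γ δ, (∃ x, M.R α β x ∧ M.R x γ δ) → ∃ y, M.R α y δ ∧ M.R β γ y) ∧
  (∀ α β γ, M.R α β γ → M.R M.s α γ ∨ M.R M.s β γ)

end BModel

/-- Semantic entailment over a class `C` of `B`-models: every model in `C`
whose designated world satisfies all of `T` also satisfies `A` at its
designated world. -/
def Entails (C : BModel σ → Prop) (T : Set (Formula σ)) (A : Formula σ) : Prop :=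
  ∀ M : BModel σ, C M → M.SatTheory T → M.SatAx A

end RM


open RM

/-- The signature of DLO: no function symbols, one binary relation `<`. -/
def dloSig : Signature := ⟨Empty, fun e => e.elim, Unit, fun _ => 2⟩

namespace DLO

/-- Variable `n` as a term of the language of DLO. -/
def v (n : ℕ) : Term dloSig := .var n

/-- The atomic formula `t < u`. -/
def lt (t u : Term dloSig) : Formula dloSig := .rel () ![t, u]

/-- A1: `∀x(x<x → ⊥)`. -/
def ax1 : Formula dloSig := .all 0 (.imp (lt (v 0) (v 0)) .falsum)
/-- A2: `∀x,y(x=y ∨ x<y ∨ y<x)`. -/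
def ax2 : Formula dloSig :=
  .all 0 (.all 1 (.or (.equal (v 0) (v 1)) (.or (lt (v 0) (v 1)) (lt (v 1) (v 0)))))
/-- A3: `∀x,y,z((x<y ∧ y<z) → x<z)`. -/
def ax3 : Formula dloSig :=
  .all 0 (.all 1 (.all 2 (.imp (.and (lt (v 0) (v 1)) (lt (v 1) (v 2))) (lt (v 0) (v 2)))))
/-- A4: `∀x,y(x<y → ∃z(x<z ∧ z<y))`. -/
def ax4 : Formula dloSig :=
  .all 0 (.all 1 (.imp (lt (v 0) (v 1)) (.ex 2 (.and (lt (v 0) (v 2)) (lt (v 2) (v 1))))))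
/-- A5: `∀x∃y(x<y)`. -/
def ax5 : Formula dloSig := .all 0 (.ex 1 (lt (v 0) (v 1)))
/-- A6: `∀x∃y(y<x)`. -/
def ax6 : Formula dloSig := .all 0 (.ex 1 (lt (v 1) (v 0)))

/-- The theory DLO of dense linear orders without endpoints. -/
def theory : Set (Formula dloSig) := {ax1, ax2, ax3, ax4, ax5, ax6}

end DLO

/-- The sentence `(∀x(x=x)) → A3`. -/
def sentA : Formula dloSig := .imp (.all 0 (.equal (DLO.v 0) (DLO.v 0))) DLO.ax3

/-- The sentence `A3 ∧ ¬A3`. -/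
def sentB : Formula dloSig := .and DLO.ax3 (.neg DLO.ax3)


/-- The classical one-world model on the rationals with their usual order. -/
def classicalRat : BModel dloSig where
  W := Unit
  R _ _ _ := True
  D := ℚ
  dne := ⟨0⟩
  star := id
  s := ()
  interpFunc f := f.elim
  V _ _ (x : Fin 2 → ℚ) := x 0 < x 1
  base _ := trivial
  btrans _ _ _ _ _ _ := trivial
  star_star _ := rfl
  star_anti _ _ _ := trivial
  hered _ _ _ _ _ h := h

/-- The two-world model on the rationals whose designated world carries the usual order, while
the star of the designated world carries the empty relation and sees every pair of worlds. -/
def twoWorldRat : BModel dloSig where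
  W := Bool
  R a b c := a = true → b = c
  D := ℚ
  dne := ⟨0⟩
  star := not
  s := true
  interpFunc f := f.elim
  V w _ (x : Fin 2 → ℚ) := w = true ∧ x 0 < x 1
  base _ _ := rfl
  btrans _ _ _ _ h h' := by rwa [h rfl]
  star_star := Bool.not_not
  star_anti _ _ h _ := congrArg not (h rfl).symm
  hered _ _ h _ _ h' := by rwa [← h rfl]

namespace RM.BModel

variable {M : BModel dloSig}

/-- The relation that `<` denotes at the world `w`. -/
def ltAt (M : BModel dloSig) (w : M.W) (d e : M.D) : Prop := M.V w () ![d, e]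

theorem truth_lt_iff (w : M.W) (a : ℕ → M.D) (m n : ℕ) :
    M.Truth w a (DLO.lt (DLO.v m) (DLO.v n)) ↔ M.ltAt w (a m) (a n) := by
  have h : (fun i => M.evalT a ((![DLO.v m, DLO.v n] : Fin 2 → Term dloSig) i)) =
      ![a m, a n] := by
    funext i
    fin_cases i <;> rfl
  exact iff_of_eq (congrArg (M.V w ()) h)

theorem truth_ax3_iff (w : M.W) (a : ℕ → M.D) :
    M.Truth w a DLO.ax3 ↔ ∀ (d e f : M.D) (w₁ w₂ : M.W), M.R w w₁ w₂ →
      M.ltAt w₁ d e ∧ M.ltAt w₁ e f → M.ltAt w₂ d f := by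
  simp [DLO.ax3, Truth, truth_lt_iff]

theorem satTheory_dlo
    (irrefl : ∀ w₁ w₂ d, M.R M.s w₁ w₂ → ¬ M.ltAt w₁ d d)
    (total : ∀ d e, d = e ∨ M.ltAt M.s d e ∨ M.ltAt M.s e d)
    (trans : ∀ d e f w₁ w₂, M.R M.s w₁ w₂ → M.ltAt w₁ d e ∧ M.ltAt w₁ e f → M.ltAt w₂ d f)
    (dense : ∀ d e w₁ w₂, M.R M.s w₁ w₂ → M.ltAt w₁ d e →
      ∃ f, M.ltAt w₂ d f ∧ M.ltAt w₂ f e)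
    (above : ∀ d, ∃ e, M.ltAt M.s d e) (below : ∀ d, ∃ e, M.ltAt M.s e d) :
    M.SatTheory DLO.theory := by
  rintro A (rfl | rfl | rfl | rfl | rfl | rfl) a
  · simpa [DLO.ax1, Truth, truth_lt_iff] using fun d w₁ w₂ h => irrefl w₁ w₂ d h
  · have h (b : ℕ → M.D) (n : ℕ) : M.evalT b (DLO.v n) = b n := rfl
    simpa [DLO.ax2, Truth, truth_lt_iff, h] using total
  · exact (truth_ax3_iff _ a).2 trans
  · simpa [DLO.ax4, Truth, truth_lt_iff] using dense
  · simpa [DLO.ax5, Truth, truth_lt_iff] using above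
  · simpa [DLO.ax6, Truth, truth_lt_iff] using below

end RM.BModel

open BModel

theorem classicalRat_satTheory : classicalRat.SatTheory DLO.theory :=
  satTheory_dlo (fun _ _ d _ => lt_irrefl (α := ℚ) d)
    (fun d e => (eq_or_ne d e).imp_right (lt_or_gt_of_ne (α := ℚ)))
    (fun _ _ _ _ _ _ h => lt_trans (α := ℚ) h.1 h.2)
    (fun _ _ _ _ _ h => exists_between (α := ℚ) h)
    (exists_gt (α := ℚ)) (exists_lt (α := ℚ))

theorem twoWorldRat_satTheory : twoWorldRat.SatTheory DLO.theory :=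
  satTheory_dlo (fun _ _ d _ h => lt_irrefl (α := ℚ) d h.2)
    (fun d e => (eq_or_ne d e).imp_right fun h =>
      (lt_or_gt_of_ne (α := ℚ) h).imp (⟨rfl, ·⟩) (⟨rfl, ·⟩))
    (fun _ _ _ _ _ hw h => ⟨(hw rfl).symm.trans h.1.1, lt_trans (α := ℚ) h.1.2 h.2.2⟩)
    (fun _ _ _ _ hw h => (exists_between (α := ℚ) h.2).imp fun _ hf =>
      ⟨⟨(hw rfl).symm.trans h.1, hf.1⟩, (hw rfl).symm.trans h.1, hf.2⟩)
    (fun d => (exists_gt (α := ℚ) d).imp fun _ h => ⟨rfl, h⟩)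
    (fun d => (exists_lt (α := ℚ) d).imp fun _ h => ⟨rfl, h⟩)

theorem classicalRat_truth_ax3 (w : Unit) (a : ℕ → ℚ) : classicalRat.Truth w a DLO.ax3 :=
  (truth_ax3_iff (M := classicalRat) w a).2 fun _ _ _ _ _ _ h => lt_trans (α := ℚ) h.1 h.2

theorem twoWorldRat_not_truth_ax3 (a : ℕ → ℚ) : ¬ twoWorldRat.Truth false a DLO.ax3 := fun h =>
  Bool.false_ne_true ((truth_ax3_iff (M := twoWorldRat) false a).1 h (0 : ℚ) (1 : ℚ) (2 : ℚ)
    true false nofun ⟨⟨rfl, zero_lt_one⟩, rfl, one_lt_two⟩).1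

/-- **Failure of ω-categoricity for DLO**: there are countable `B`-models of
DLO that disagree on the sentences `(∀x(x=x)) → A3` and `A3 ∧ ¬A3`, hence are
not elementarily equivalent. -/
theorem stmt_6 :
    ∃ M N : BModel dloSig, Countable M.D ∧ Countable N.D ∧
      M.SatTheory DLO.theory ∧ N.SatTheory DLO.theory ∧
      M.SatAx sentA ∧ ¬ N.SatAx sentA ∧ N.SatAx sentB ∧ ¬ M.SatAx sentB := by
  let zero : ℕ → ℚ := fun _ => 0
  refine ⟨classicalRat, twoWorldRat, inferInstanceAs (Countable ℚ), inferInstanceAs (Countable ℚ),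
    classicalRat_satTheory, twoWorldRat_satTheory, ?_, ?_, ?_, ?_⟩
  · exact fun a _ w _ _ => classicalRat_truth_ax3 w a
  · exact fun h => twoWorldRat_not_truth_ax3 zero
      (h zero false false (fun _ => rfl) fun _ => rfl)
  · exact fun a => ⟨twoWorldRat_satTheory _ (by simp [DLO.theory]) a, twoWorldRat_not_truth_ax3 a⟩
  · exact fun h => (h zero).2 (classicalRat_truth_ax3 () zero)
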